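/- Let G be a finite group, N a normal subgroup of G, X a left G-set, Y the set of N-orbits on X with its induced G/N-action, p : X → Y the orbit map, ζ : Y → X a section of p, and A a G-module. Let β : G → Maps(X, A) be such that the map AWES²(d(β)) : G × G/N → Maps(Y, A) (taking Γ = G with the identity homomorphism) depends on its first argument only through its image in G/N. Then AWES¹(β) takes values in Maps(Y, A^N), i.e. AWES¹(β)(σ)(y) is N-invariant for all σ ∈ G/N and y ∈ Y. -/

import Mathlib

/-- The map `AWES¹`: for `β : G → Maps(X,A)`,
`AWES¹(β)(σ)(σ·w) = ∏_{n∈N} β(n σ̃)(n σ̃ · ζ(w)) / β(n)(n · ζ(σ·w))`,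
written at an arbitrary point `y = σ·w` of `Y`, with lift `σ̃ = L σ`. -/
def AWES1 {G X Y A : Type*} [Group G] [MulAction G X] [CommGroup A]
    (N : Subgroup G) [N.Normal] [Fintype N] [MulAction (G ⧸ N) Y]
    (ζ : Y → X) (L : G ⧸ N → G)
    (β : G → X → A) (σ : G ⧸ N) (y : Y) : A :=
  ∏ n : N,
    β ((n : G) * L σ) (((n : G) * L σ) • ζ (σ⁻¹ • y)) /
      β (n : G) ((n : G) • ζ y)

/-- The map `AWES²` (here with `Γ = G` and `π = id`): for `α : G × G → Maps(X,A)`,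
`AWES²(α)(σ,τ)(σ_N τ · w) = ∏_{n∈N} α(σ, n τ̃)(σ n τ̃ · ζ(w)) / α(σ, n)(σ n · ζ(τ·w))`,
written at an arbitrary point `y = σ_N τ · w` of `Y`, with lift `τ̃ = L τ`. -/
def AWES2 {G X Y A : Type*} [Group G] [MulAction G X] [CommGroup A]
    (N : Subgroup G) [N.Normal] [Fintype N] [MulAction (G ⧸ N) Y]
    (ζ : Y → X) (L : G ⧸ N → G)
    (α : G → G → X → A) (σ : G) (τ : G ⧸ N) (y : Y) : A :=
  ∏ n : N,
    α σ ((n : G) * L τ)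
        ((σ * ((n : G) * L τ)) • ζ ((((σ : G ⧸ N)) * τ)⁻¹ • y)) /
      α σ (n : G) ((σ * (n : G)) • ζ (((σ : G ⧸ N))⁻¹ • y))

/-- The product over `N` of a function along the `N`-orbit map does not depend on the point
chosen in the orbit. -/
theorem prod_smul_eq_of_mem_orbit {G X M : Type*} [Group G] [MulAction G X] [CommMonoid M]
    (N : Subgroup G) [Fintype N] (f : X → M) {x x' : X} (h : ∃ n : N, (n : G) • x = x') :
    ∏ n : N, f ((n : G) • x') = ∏ n : N, f ((n : G) • x) := by
  obtain ⟨k, rfl⟩ := h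
  refine Fintype.prod_equiv (Equiv.mulRight k) _ _ fun n => ?_
  simp [mul_smul]

/-- On `N`, the map `AWES²(d(β))` is the coboundary of `AWES¹(β)`. -/
theorem AWES2_coboundary_of_mem {G X Y A : Type*} [Group G]
    (N : Subgroup G) [N.Normal] [Fintype N]
    [MulAction G X] [MulAction (G ⧸ N) Y]
    (p : X → Y) (hp : ∀ (g : G) (x : X), p (g • x) = ((g : G ⧸ N)) • p x)
    (hfib : ∀ x x' : X, p x = p x' ↔ ∃ n : N, (n : G) • x = x')
    (ζ : Y → X) (hζ : ∀ y : Y, p (ζ y) = y)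
    (L : G ⧸ N → G) (hL : ∀ q : G ⧸ N, ((L q : G) : G ⧸ N) = q)
    [CommGroup A] [MulDistribMulAction G A]
    (β : G → X → A) (m : N) (τ : G ⧸ N) (y : Y) :
    AWES2 N ζ L
        (fun g g' x => β g x * g • β g' (g⁻¹ • x) * (β (g * g') x)⁻¹) (m : G) τ y
      = (m : G) • AWES1 N ζ L β τ y / AWES1 N ζ L β τ y := by
  have hm : ((m : G) : G ⧸ N) = 1 := (QuotientGroup.eq_one_iff _).2 m.2
  have horb : ∏ n : N, β m ((m : G) • (n : G) • ζ y)
      = ∏ n : N, β m ((m : G) • (n : G) • L τ • ζ (τ⁻¹ • y)) :=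
    prod_smul_eq_of_mem_orbit N (fun x => β m ((m : G) • x))
      ((hfib _ _).1 (by rw [hp, hL, hζ, hζ, smul_inv_smul]))
  have hshift : AWES1 N ζ L β τ y =
      ∏ n : N, β ((m : G) * (n * L τ)) (((m : G) * (n * L τ)) • ζ (τ⁻¹ • y)) /
        β ((m : G) * n) (((m : G) * n) • ζ y) :=
    (Fintype.prod_equiv (Equiv.mulLeft m) _ _ fun n => by simp [mul_assoc]).symm
  conv_rhs => arg 2; rw [hshift]
  simp only [AWES1, AWES2, hm, one_mul, inv_one, one_smul, Finset.smul_prod', smul_div',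
    Finset.prod_div_distrib, Finset.prod_mul_distrib, Finset.prod_inv_distrib, mul_smul,
    inv_smul_smul, horb]
  rw [mul_assoc, mul_assoc, mul_div_mul_left_eq_div, ← div_eq_mul_inv, ← div_eq_mul_inv,
    div_div_div_comm]

/-- If `β : G → Maps(X,A)` is such that `AWES²(d(β))` depends on its
first argument only through its image in `G/N`, then `AWES¹(β)` takes values in
`Maps(Y, A^N)`. Here `Y` is the set of `N`-orbits of the `G`-set `X` (encoded by
an equivariant surjection `p` whose fibers are the `N`-orbits, with section `ζ`),
`A` is a `G`-module and `d(β)(σ,τ)(x) = β(σ)(x)·σ(β(τ)(σ⁻¹·x))·β(στ)(x)⁻¹`. -/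
theorem AWES1_valued_in_invariants {G X Y A : Type*}
    [Group G] [Fintype G]
    (N : Subgroup G) [N.Normal] [Fintype N]
    [MulAction G X] [MulAction (G ⧸ N) Y]
    (p : X → Y) (hp : ∀ (g : G) (x : X), p (g • x) = ((g : G ⧸ N)) • p x)
    (hfib : ∀ x x' : X, p x = p x' ↔ ∃ n : N, (n : G) • x = x')
    (ζ : Y → X) (hζ : ∀ y : Y, p (ζ y) = y)
    (L : G ⧸ N → G) (hL : ∀ q : G ⧸ N, ((L q : G) : G ⧸ N) = q)
    [CommGroup A] [MulDistribMulAction G A]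
    (β : G → X → A)
    (hfactor : ∀ σ σ' : G, ((σ : G ⧸ N)) = ((σ' : G ⧸ N)) →
      ∀ (τ : G ⧸ N) (y : Y),
        AWES2 N ζ L
            (fun g g' x => β g x * g • β g' (g⁻¹ • x) * (β (g * g') x)⁻¹) σ τ y
          = AWES2 N ζ L
              (fun g g' x => β g x * g • β g' (g⁻¹ • x) * (β (g * g') x)⁻¹) σ' τ y) :
    ∀ (σ : G ⧸ N) (y : Y) (m : N),
      (m : G) • AWES1 N ζ L β σ y = AWES1 N ζ L β σ y := by
  intro σ y m
  have h := hfactor m (1 : N) (by simp [(QuotientGroup.eq_one_iff _).2 m.2]) σ y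
  rw [AWES2_coboundary_of_mem N p hp hfib ζ hζ L hL,
    AWES2_coboundary_of_mem N p hp hfib ζ hζ L hL] at h
  simpa [div_eq_one] using h
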